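/- arXiv:2201.01438 — 3 statements merged into one kernel-verified Lean document; each statement's English description precedes it below -/
import Mathlib

section
/- Let θ̂ ∈ (π, 5π/4), let ℓ ∈ [1, −sec(θ̂)), and let Ω₀, Ω₂, Ω₃, Ω₄ be real numbers with Ω₂ > 0 and Ω₄ > 0 satisfying sin²(θ̂)·Ω₀ − 6Ω₂ + 8·cot(θ̂)·Ω₃ − (3csc²(θ̂) − 4)·Ω₄ = 0. Define, for t ∈ [0, 1]: c₂(t) := (1 + (1−t)·ℓ·cos(θ̂))^{2/3}; c₁(t) := t; c₀(t) := (sin²(θ̂)·Ω₀ − 6c₂(t)·Ω₂ + 8c₁(t)·cot(θ̂)·Ω₃)/((3csc²(θ̂) − 4)·Ω₄); θ(t) := (1/3)·arccos(c₁(t)·cos(θ̂)/c₂(t)^{3/2}) (standard arccosine with values in [0, π]); and c̃₀(t) := 3csc²(θ̂) − 4 + 24·c₂(t)²·csc²(θ̂)·cos²(θ(t))·cos(2θ(t)). Assume that for every t ∈ [0, 1): Ω₃ < (3(1 − c₂(t))·tan(θ̂)/(4(1−t)))·Ω₂ + (c̃₀(t)·tan(θ̂)/(8(1−t)))·Ω₄.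 Then: (i) for every t ∈ [0, 1], sin²(θ̂)·Ω₀ − 6c₂(t)·Ω₂ + 8c₁(t)·cot(θ̂)·Ω₃ − c₀(t)·(3csc²(θ̂) − 4)·Ω₄ = 0; (ii) c₂(1) = c₁(1) = c₀(1) = 1, c₂(0) > 0 and c₁(0) = 0; (iii) for every t ∈ [0, 1], (3csc²(θ̂) − 4)·c₀(t) > −24·c₂(t)²·csc²(θ̂)·cos²(θ(t))·cos(2θ(t)); (iv) for every t ∈ [0, 1], (d/dt)(c₂(t)^{3/2}) ≥ −cos(θ̂)·c₁'(t), c₂'(t) > 0 and c₁'(t) > 0; and moreover (v) c̃₀(t) > 0 for every t ∈ [0, 1]. -/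
lemma key_poly (y v C X S : ℝ) (hy : 1 / 2 < y) (hv0 : 0 ≤ v) (hv : v ≤ 1) (hC : 1 / 2 < C ^ 2)
    (hS : S = 1 - C ^ 2) (hX0 : 0 ≤ X) (hXC : X ≤ C) (hX : X = 3 * y - 4 * y ^ 3) :
    0 < 3 - 4 * S + 24 * v ^ 2 * y ^ 2 * (2 * y ^ 2 - 1) := by
  subst hS
  rcases le_or_gt (1 / 2) (y ^ 2) with h | h
  · have : 0 ≤ 24 * v ^ 2 * y ^ 2 * (2 * y ^ 2 - 1) :=
      mul_nonneg (by positivity) (by linarith)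
    linarith
  · have hz : 1 / 4 < y ^ 2 := by nlinarith
    have h1 : 0 < (4 * y ^ 2 - 1) ^ 3 := pow_pos (by linarith) 3
    have h2 : 4 * X ^ 2 - 1 = (4 * y ^ 2 - 1) ^ 3 + 24 * y ^ 2 * (1 - 2 * y ^ 2) := by
      rw [hX]; ring
    have h3 : X ^ 2 ≤ C ^ 2 := pow_le_pow_left₀ hX0 hXC 2
    have h4 : v ^ 2 ≤ 1 := pow_le_one₀ hv0 hv
    have h5 : 0 ≤ (1 - v ^ 2) * (24 * y ^ 2 * (1 - 2 * y ^ 2)) :=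
      mul_nonneg (by linarith) (mul_nonneg (by positivity) (by linarith))
    nlinarith

set_option maxHeartbeats 1000000 in
/-- If `(Ω₂, Ω₃, Ω₄) ∈ Ω^{4,θ̂}_ℓ`, then the triple
`c₂(t) = (1 + (1−t)ℓ cos θ̂)^{2/3}`, `c₁(t) = t`, `c₀(t)` determined by the topological
constraint, satisfies all four constraints of the four-dimensional continuity path,
and moreover `c̃₀(t) > 0` on `[0,1]`. -/
theorem stmt_17 (θ : ℝ) (hθ : θ ∈ Set.Ioo Real.pi (5 * Real.pi / 4))
    (ℓ : ℝ) (hℓ : ℓ ∈ Set.Ico (1 : ℝ) (-(1 / Real.cos θ)))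
    (Ω₀ Ω₂ Ω₃ Ω₄ : ℝ) (h2 : 0 < Ω₂) (h4 : 0 < Ω₄)
    (htop : Real.sin θ ^ 2 * Ω₀ - 6 * Ω₂ + 8 * (Real.cos θ / Real.sin θ) * Ω₃
      - (3 / Real.sin θ ^ 2 - 4) * Ω₄ = 0)
    (c₂ c₁ c₀ θt ct : ℝ → ℝ)
    (hc₂ : c₂ = fun t => (1 + (1 - t) * ℓ * Real.cos θ) ^ ((2 : ℝ) / 3))
    (hc₁ : c₁ = fun t => t)
    (hc₀ : c₀ = fun t => (Real.sin θ ^ 2 * Ω₀ - 6 * c₂ t * Ω₂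
      + 8 * c₁ t * (Real.cos θ / Real.sin θ) * Ω₃) / ((3 / Real.sin θ ^ 2 - 4) * Ω₄))
    (hθt : θt = fun t => (1 / 3) * Real.arccos (c₁ t * Real.cos θ / c₂ t ^ ((3 : ℝ) / 2)))
    (hct : ct = fun t => 3 / Real.sin θ ^ 2 - 4
      + 24 * c₂ t ^ 2 * (1 / Real.sin θ ^ 2) * Real.cos (θt t) ^ 2 * Real.cos (2 * θt t))
    (hΩ : ∀ t ∈ Set.Ico (0 : ℝ) 1,
      Ω₃ < 3 * (1 - c₂ t) * (Real.sin θ / Real.cos θ) / (4 * (1 - t)) * Ω₂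
        + ct t * (Real.sin θ / Real.cos θ) / (8 * (1 - t)) * Ω₄) :
    (∀ t ∈ Set.Icc (0 : ℝ) 1,
      Real.sin θ ^ 2 * Ω₀ - 6 * c₂ t * Ω₂ + 8 * c₁ t * (Real.cos θ / Real.sin θ) * Ω₃
        - c₀ t * (3 / Real.sin θ ^ 2 - 4) * Ω₄ = 0) ∧
    (c₂ 1 = 1 ∧ c₁ 1 = 1 ∧ c₀ 1 = 1 ∧ 0 < c₂ 0 ∧ c₁ 0 = 0) ∧
    (∀ t ∈ Set.Icc (0 : ℝ) 1,
      -24 * c₂ t ^ 2 * (1 / Real.sin θ ^ 2) * Real.cos (θt t) ^ 2 * Real.cos (2 * θt t)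
        < (3 / Real.sin θ ^ 2 - 4) * c₀ t) ∧
    (∀ t ∈ Set.Icc (0 : ℝ) 1,
      -Real.cos θ * deriv c₁ t ≤ deriv (fun s => c₂ s ^ ((3 : ℝ) / 2)) t ∧
      0 < deriv c₂ t ∧ 0 < deriv c₁ t) ∧
    (∀ t ∈ Set.Icc (0 : ℝ) 1, 0 < ct t) := by
  obtain ⟨hθ1, hθ2⟩ := hθ
  obtain ⟨hℓ1, hℓ2⟩ := hℓ
  have hpi := Real.pi_pos
  have hs : Real.sin θ < 0 := by
    have := Real.sin_pos_of_pos_of_lt_pi (x := θ - Real.pi) (by linarith) (by linarith)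
    rw [Real.sin_sub_pi] at this; linarith
  have hcos : √2 / 2 < -Real.cos θ := by
    have := Real.cos_lt_cos_of_nonneg_of_le_pi (x := θ - Real.pi) (y := Real.pi / 4)
      (by linarith) (by linarith) (by linarith)
    rw [Real.cos_sub_pi, Real.cos_pi_div_four] at this; exact this
  have hsq := Real.sin_sq_add_cos_sq θ
  set s := Real.sin θ
  set c := Real.cos θ
  have hr2 : √2 ^ 2 = 2 := Real.sq_sqrt (by norm_num)
  have hr0 : 0 < √2 := by positivity
  have hc : c < 0 := by linarith
  have hC : 1 / 2 < (-c) ^ 2 := by nlinarith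
  have hC1 : -c ≤ 1 := by nlinarith
  have hs2 : 0 < s ^ 2 := by nlinarith
  have hs2' : s ^ 2 < 1 / 2 := by nlinarith
  have hK : 0 < 3 / s ^ 2 - 4 := by
    have : 4 < 3 / s ^ 2 := by rw [lt_div_iff₀ hs2]; linarith
    linarith
  have hlc : 0 < 1 + ℓ * c := by
    have h : -(1 / c) = 1 / (-c) := by rw [div_neg]
    rw [h, lt_div_iff₀ (by linarith)] at hℓ2
    linarith
  have hu : ∀ t ∈ Set.Icc (0 : ℝ) 1, 0 < 1 + (1 - t) * ℓ * c := by
    rintro t ⟨h0, h1⟩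
    have : 0 ≤ t * (ℓ * (-c)) := mul_nonneg h0 (mul_nonneg (by linarith) (by linarith))
    linarith
  have hu1 : ∀ t ∈ Set.Icc (0 : ℝ) 1, 1 + (1 - t) * ℓ * c ≤ 1 := by
    rintro t ⟨h0, h1⟩
    have : 0 ≤ (1 - t) * ℓ * (-c) := by
      apply mul_nonneg (mul_nonneg _ _) <;> linarith
    linarith
  have hut : ∀ t ∈ Set.Icc (0 : ℝ) 1, t ≤ 1 + (1 - t) * ℓ * c := by
    rintro t ⟨h0, h1⟩
    nlinarith
  have hpow : ∀ t, 0 < 1 + (1 - t) * ℓ * c → c₂ t ^ ((3 : ℝ) / 2) = 1 + (1 - t) * ℓ * c := by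
    intro t ht
    rw [hc₂]
    simp only
    rw [← Real.rpow_mul ht.le]
    norm_num
  have hc2pos : ∀ t ∈ Set.Icc (0 : ℝ) 1, 0 < c₂ t := by
    intro t ht
    rw [hc₂]
    exact Real.rpow_pos_of_pos (hu t ht) _
  have hc2le : ∀ t ∈ Set.Icc (0 : ℝ) 1, c₂ t ≤ 1 := by
    intro t ht
    rw [hc₂]
    exact Real.rpow_le_one (hu t ht).le (hu1 t ht) (by norm_num)
  have hctpos : ∀ t ∈ Set.Icc (0 : ℝ) 1, 0 < ct t := by
    intro t ht
    have hut' := hu t ht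
    have hx : c₁ t * c / c₂ t ^ ((3 : ℝ) / 2) = -(t * (-c) / (1 + (1 - t) * ℓ * c)) := by
      rw [hpow t hut', hc₁]; ring
    have hX0 : 0 ≤ t * (-c) / (1 + (1 - t) * ℓ * c) :=
      div_nonneg (mul_nonneg ht.1 (by linarith)) hut'.le
    have hXC : t * (-c) / (1 + (1 - t) * ℓ * c) ≤ -c := by
      rw [div_le_iff₀ hut']
      nlinarith [hut t ht]
    have hCl : -c < 1 := by nlinarith
    have hθ' : θt t = Real.arccos (-(t * (-c) / (1 + (1 - t) * ℓ * c))) / 3 := by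
      rw [hθt]; simp only; rw [hx]; ring
    generalize t * (-c) / (1 + (1 - t) * ℓ * c) = X at *
    have h3 : Real.cos (3 * θt t) = -X := by
      rw [hθ', mul_div_cancel₀ _ (by norm_num : (3 : ℝ) ≠ 0)]
      exact Real.cos_arccos (by linarith) (by linarith)
    have hφ0 : 0 ≤ θt t := by
      rw [hθ']; have := Real.arccos_nonneg (-X); linarith
    have hφ1 : θt t < Real.pi / 3 := by
      have h1 : Real.arccos (-X) ≤ Real.pi := Real.arccos_le_pi _
      have h2 : Real.arccos (-X) ≠ Real.pi := by
        intro h; rw [Real.arccos_eq_pi] at h; linarith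
      have := lt_of_le_of_ne h1 h2
      rw [hθ']; linarith
    have hy : 1 / 2 < Real.cos (θt t) := by
      rw [← Real.cos_pi_div_three]
      exact Real.cos_lt_cos_of_nonneg_of_le_pi hφ0 (by linarith) hφ1
    rw [Real.cos_three_mul] at h3
    have key := key_poly (Real.cos (θt t)) (c₂ t) (-c) X (s ^ 2) hy (hc2pos t ht).le
      (hc2le t ht) hC (by linarith) hX0 hXC (by linarith)
    have : ct t = (3 - 4 * s ^ 2 + 24 * c₂ t ^ 2 * Real.cos (θt t) ^ 2 *
        (2 * Real.cos (θt t) ^ 2 - 1)) / s ^ 2 := by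
      rw [hct]; simp only; rw [Real.cos_two_mul]
      have := hs.ne
      field_simp
    rw [this]
    exact div_pos key hs2
  have hc0 : ∀ t, c₀ t * (3 / s ^ 2 - 4) * Ω₄ = s ^ 2 * Ω₀ - 6 * c₂ t * Ω₂
      + 8 * c₁ t * (c / s) * Ω₃ := by
    intro t
    rw [hc₀]
    simp only
    rw [mul_assoc]
    exact div_mul_cancel₀ _ (mul_pos hK h4).ne'
  have hc21 : c₂ 1 = 1 := by rw [hc₂]; simp
  have hc11 : c₁ 1 = 1 := by rw [hc₁]
  have hcot : 0 < c / s := div_pos_of_neg_of_neg hc hs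
  have hctdef : ∀ t, ct t = 3 / s ^ 2 - 4
      + 24 * c₂ t ^ 2 * (1 / s ^ 2) * Real.cos (θt t) ^ 2 * Real.cos (2 * θt t) := by
    intro t; rw [hct]
  clear hct hθt
  refine ⟨?_, ⟨hc21, hc11, ?_, hc2pos 0 (by simp), by rw [hc₁]⟩, ?_, ?_, hctpos⟩
  · intro t _
    rw [hc0]; ring
  · have h := hc0 1
    rw [hc21, hc11] at h
    have h' : (c₀ 1 - 1) * ((3 / s ^ 2 - 4) * Ω₄) = 0 := by linarith
    rcases mul_eq_zero.1 h' with h'' | h''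
    · linarith
    · exact absurd h'' (mul_pos hK h4).ne'
  · intro t ht
    have hmain : 8 * (1 - t) * (c / s) * Ω₃ < 6 * (1 - c₂ t) * Ω₂ + ct t * Ω₄ := by
      rcases ht.2.lt_or_eq with h1 | h1
      · have h := hΩ t ⟨ht.1, h1⟩
        have hp : 0 < 8 * (1 - t) * (c / s) := mul_pos (by linarith) hcot
        have h' := mul_lt_mul_of_pos_left h hp
        have ht1 : 1 - t ≠ 0 := by linarith
        have e : 8 * (1 - t) * (c / s) * (3 * (1 - c₂ t) * (s / c) / (4 * (1 - t)) * Ω₂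
          + ct t * (s / c) / (8 * (1 - t)) * Ω₄) = 6 * (1 - c₂ t) * Ω₂ + ct t * Ω₄ := by
          have := hs.ne
          have := hc.ne
          field_simp
          ring
        rwa [e] at h'
      · subst h1
        have := mul_pos (hctpos 1 ht) h4
        rw [hc21]
        linarith
    have h := hc0 t
    have hc1t : c₁ t = t := by rw [hc₁]
    rw [hc1t] at h
    rw [hctdef t] at hmain
    refine lt_of_mul_lt_mul_right ?_ h4.le
    linarith
  · intro t ht
    have hut' := hu t ht
    have hd : HasDerivAt (fun r : ℝ => 1 + (1 - r) * ℓ * c) (-(ℓ * c)) t := by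
      have := ((((hasDerivAt_id t).const_sub 1).mul_const ℓ).mul_const c).const_add 1
      have e : -1 * ℓ * c = -(ℓ * c) := by ring
      rw [e] at this
      exact this
    have hev : (fun r => c₂ r ^ ((3 : ℝ) / 2)) =ᶠ[nhds t] fun r : ℝ => 1 + (1 - r) * ℓ * c := by
      filter_upwards [hd.continuousAt.eventually (lt_mem_nhds hut')] with r hr
      exact hpow r hr
    have hd1 : deriv c₁ t = 1 := by rw [hc₁]; exact (hasDerivAt_id t).deriv
    rw [hev.deriv_eq, hd.deriv, hd1]
    refine ⟨by nlinarith, ?_, one_pos⟩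
    have hd2 := hd.rpow_const (p := (2 : ℝ) / 3) (Or.inl hut'.ne')
    rw [hc₂, hd2.deriv]
    have := Real.rpow_pos_of_pos hut' ((2 : ℝ) / 3 - 1)
    have : 0 < -(ℓ * c) := by nlinarith
    positivity
end

section
/- Let θ̂ ∈ (π, 5π/4) and let Ω₂, Ω₃, Ω₄ be real numbers with Ω₄ > 0, Ω₂ > csc²(θ̂)·Ω₄, and 3Ω₂ − 6·cot(θ̂)·Ω₃ + (3csc²(θ̂) − 4)·Ω₄ > 0. Then there exists ℓ ∈ [1, −sec(θ̂)) such that for every t ∈ [0, 1): Ω₃ < (3(1 − c₂(t))·tan(θ̂)/(4(1−t)))·Ω₂ + (c̃₀(t)·tan(θ̂)/(8(1−t)))·Ω₄, where c₂(t) := (1 + (1−t)·ℓ·cos(θ̂))^{2/3}, θ(t) := (1/3)·arccos(t·cos(θ̂)/c₂(t)^{3/2}) (standard arccosine with values in [0, π]), and c̃₀(t) := 3csc²(θ̂) − 4 + 24·c₂(t)²·csc²(θ̂)·cos²(θ(t))·cos(2θ(t)). -/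
/-- The trigonometric factor. -/
noncomputable def gAux (v : ℝ) : ℝ :=
  Real.cos ((1 / 3) * Real.arccos v) ^ 2 * Real.cos (2 * ((1 / 3) * Real.arccos v))

theorem gAux_cont : Continuous gAux := by
  unfold gAux
  have := Real.continuous_arccos
  fun_prop

theorem gAux_bdd (v : ℝ) : |gAux v| ≤ 1 := by
  unfold gAux
  rw [abs_mul, abs_pow]
  have h1 := Real.abs_cos_le_one ((1 / 3) * Real.arccos v)
  have h2 := Real.abs_cos_le_one (2 * ((1 / 3) * Real.arccos v))
  exact mul_le_one₀ (pow_le_one₀ (abs_nonneg _) h1) (abs_nonneg _) h2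

theorem Q_cont (k c t : ℝ) (hc : 0 ≤ c) :
    ContinuousAt (fun q : ℝ × ℝ => q.1 ^ 2 * gAux (q.2 * k / q.1 ^ ((3 : ℝ) / 2))) (c, t) := by
  rcases hc.eq_or_lt with h | h
  · subst h
    unfold ContinuousAt
    have h0 : Filter.Tendsto (fun q : ℝ × ℝ => q.1 ^ 2) (nhds (0, t)) (nhds 0) := by
      have : Continuous (fun q : ℝ × ℝ => q.1 ^ 2) := by fun_prop
      simpa using this.tendsto (0, t)
    simp only [ne_eq, OfNat.ofNat_ne_zero, not_false_eq_true, zero_pow, zero_mul]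
    apply squeeze_zero_norm (a := fun q : ℝ × ℝ => q.1 ^ 2) _ h0
    intro q
    rw [Real.norm_eq_abs, abs_mul, abs_of_nonneg (sq_nonneg q.1)]
    have := gAux_bdd (q.2 * k / q.1 ^ ((3 : ℝ) / 2))
    nlinarith [sq_nonneg q.1]
  · have h1 : ContinuousAt (fun q : ℝ × ℝ => q.1 ^ ((3 : ℝ) / 2)) (c, t) :=
      continuousAt_fst.rpow_const (Or.inr (by norm_num))
    have h2 : ContinuousAt (fun q : ℝ × ℝ => q.2 * k / q.1 ^ ((3 : ℝ) / 2)) (c, t) :=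
      (continuousAt_snd.mul continuousAt_const).div h1 (Real.rpow_pos_of_pos h _).ne'
    exact (continuousAt_fst.pow 2).mul (gAux_cont.continuousAt.comp h2)

/-- The basic polynomial inequality. -/
theorem poly_pos (u w : ℝ) (hu0 : 0 ≤ u) (hu1 : u ≤ 1) (hw0 : 0 < w) (hw1 : w < 1) :
    0 < (1 - u) ^ 3 * (1 + 3 * u)
      + w ^ 2 * ((1 - w) * ((1 - u) ^ 2 * (1 + 2 * u + 3 * u ^ 2))
        + w * (2 / 3 - 8 / 3 * u ^ 3 + 3 * u ^ 4)) := by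
  have h1 : 0 ≤ (1 - u) ^ 3 * (1 + 3 * u) :=
    mul_nonneg (pow_nonneg (by linarith) _) (by linarith)
  have h2 : 0 ≤ (1 - w) * ((1 - u) ^ 2 * (1 + 2 * u + 3 * u ^ 2)) :=
    mul_nonneg (by linarith) (by positivity)
  have h3 : 0 < 2 / 3 - 8 / 3 * u ^ 3 + 3 * u ^ 4 := by
    nlinarith [sq_nonneg (u ^ 2 - 4 / 9 * u - 8 / 81), sq_nonneg (u - 2 / 3), sq_nonneg (u * (u - 2 / 3)), sq_nonneg (u ^ 2 - 4 / 9)]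
  positivity

theorem main_poly (u x k : ℝ) (hu0 : 0 ≤ u) (hu1 : u ≤ 1) (hx : 4 * x ^ 3 - 3 * x = k)
    (hw0 : 1 / 4 < x ^ 2) (hw1 : x ^ 2 < 1 / 2) :
    0 < 2 * (1 - 3 * u ^ 2 + 2 * u ^ 3) + (4 * k ^ 2 - 1) * (4 * u ^ 3 - 1) / 3
      + 24 * u ^ 4 * (x ^ 2 * (2 * x ^ 2 - 1)) := by
  have := poly_pos u (4 * x ^ 2 - 1) hu0 hu1 (by linarith) (by linarith)
  subst hx
  convert this using 1
  ring

theorem F_pos (C S Ω₂ Ω₃ Ω₄ u Q x : ℝ) (hS : 0 < S) (hCS : S = 1 - C ^ 2) (R : ℝ)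
    (h4 : 0 < Ω₄) (hC1 : Ω₄ / S < Ω₂)
    (hC2 : 0 < 3 * Ω₂ - 6 * R * Ω₃ + (3 / S - 4) * Ω₄)
    (hu0 : 0 ≤ u) (hu1 : u ≤ 1) (hx : 4 * x ^ 3 - 3 * x = C)
    (hw0 : 1 / 4 < x ^ 2) (hw1 : x ^ 2 < 1 / 2)
    (hQ : Q = u ^ 4 * (x ^ 2 * (2 * x ^ 2 - 1))) :
    0 < 6 * (1 - u ^ 2) * Ω₂ + (3 / S - 4 + 24 * (1 / S) * Q) * Ω₄
      - 8 * (1 - u ^ 3) * R * Ω₃ := by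
  have hm := main_poly u x C hu0 hu1 hx hw0 hw1
  have hu3 : 0 ≤ 1 - u ^ 3 := sub_nonneg.2 (pow_le_one₀ hu0 hu1)
  have a1 := mul_nonneg hu3 hC2.le
  have a2 : 0 ≤ 2 * ((1 - u) ^ 2 * (1 + 2 * u)) * (Ω₂ - Ω₄ / S) :=
    mul_nonneg (by positivity) (by linarith)
  have a3 := mul_pos (div_pos h4 hS) hm
  have key : 6 * (1 - u ^ 2) * Ω₂ + (3 / S - 4 + 24 * (1 / S) * Q) * Ω₄
      - 8 * (1 - u ^ 3) * R * Ω₃ =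
      4 / 3 * ((1 - u ^ 3) * (3 * Ω₂ - 6 * R * Ω₃ + (3 / S - 4) * Ω₄))
      + 2 * ((1 - u) ^ 2 * (1 + 2 * u)) * (Ω₂ - Ω₄ / S)
      + Ω₄ / S * (2 * (1 - 3 * u ^ 2 + 2 * u ^ 3) + (4 * C ^ 2 - 1) * (4 * u ^ 3 - 1) / 3
      + 24 * u ^ 4 * (x ^ 2 * (2 * x ^ 2 - 1))) := by
    have hC : C ^ 2 = 1 - S := by linarith
    rw [hQ, hC]
    field_simp
    ring
  rw [key]
  linarith

theorem x_facts (θ : ℝ) (hθ : θ ∈ Set.Ioo Real.pi (5 * Real.pi / 4)) :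
    ∃ x : ℝ, 4 * x ^ 3 - 3 * x = Real.cos θ ∧ 1 / 4 < x ^ 2 ∧ x ^ 2 < 1 / 2 ∧
      gAux (Real.cos θ) = x ^ 2 * (2 * x ^ 2 - 1) := by
  obtain ⟨h1, h2⟩ := hθ
  have hpi := Real.pi_pos
  have ha : Real.arccos (Real.cos θ) = 2 * Real.pi - θ := by
    rw [← Real.cos_two_pi_sub θ]
    exact Real.arccos_cos (by linarith) (by linarith)
  refine ⟨Real.cos ((1 / 3) * (2 * Real.pi - θ)), ?_, ?_, ?_, ?_⟩
  · rw [← Real.cos_three_mul, ← Real.cos_two_pi_sub θ]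
    congr 1
    ring
  · have : Real.cos (Real.pi / 3) < Real.cos ((1 / 3) * (2 * Real.pi - θ)) :=
      Real.cos_lt_cos_of_nonneg_of_le_pi (by linarith) (by linarith) (by linarith)
    rw [Real.cos_pi_div_three] at this
    nlinarith
  · have : Real.cos ((1 / 3) * (2 * Real.pi - θ)) < Real.cos (Real.pi / 4) :=
      Real.cos_lt_cos_of_nonneg_of_le_pi (by linarith) (by linarith) (by linarith)
    have h0 : 0 < Real.cos ((1 / 3) * (2 * Real.pi - θ)) :=
      Real.cos_pos_of_mem_Ioo ⟨by linarith, by linarith⟩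
    rw [Real.cos_pi_div_four] at this
    have h3 : (Real.sqrt 2) ^ 2 = 2 := Real.sq_sqrt (by norm_num)
    nlinarith
  · unfold gAux
    rw [ha, Real.cos_two_mul]

/-- The function whose positivity is the claim. -/
noncomputable def FAux (C S R Ω₂ Ω₃ Ω₄ l t : ℝ) : ℝ :=
  6 * (1 - (1 + (1 - t) * l * C) ^ ((2 : ℝ) / 3)) * Ω₂
    + (3 / S - 4 + 24 * (1 / S) * (((1 + (1 - t) * l * C) ^ ((2 : ℝ) / 3)) ^ 2
      * gAux (t * C / ((1 + (1 - t) * l * C) ^ ((2 : ℝ) / 3)) ^ ((3 : ℝ) / 2)))) * Ω₄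
    - 8 * (1 - t) * R * Ω₃

theorem FAux_cont (C S R Ω₂ Ω₃ Ω₄ l t : ℝ) (h : 0 ≤ 1 + (1 - t) * l * C) :
    ContinuousAt (fun q : ℝ × ℝ => FAux C S R Ω₂ Ω₃ Ω₄ q.1 q.2) (l, t) := by
  have h1 : ContinuousAt (fun q : ℝ × ℝ => (1 + (1 - q.2) * q.1 * C) ^ ((2 : ℝ) / 3)) (l, t) := by
    apply ContinuousAt.rpow_const
    · fun_prop
    · right; norm_num
  have h2 : ContinuousAt (fun q : ℝ × ℝ => ((1 + (1 - q.2) * q.1 * C) ^ ((2 : ℝ) / 3), q.2))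
      (l, t) := h1.prodMk continuousAt_snd
  have h3 := ContinuousAt.comp (x := ((l, t) : ℝ × ℝ)) (Q_cont C _ t (Real.rpow_nonneg h _)) h2
  simp only [Function.comp_def] at h3
  unfold FAux
  have h4 : ContinuousAt (fun q : ℝ × ℝ => 8 * (1 - q.2) * R * Ω₃) (l, t) := by fun_prop
  exact (((continuousAt_const.mul (continuousAt_const.sub h1)).mul continuousAt_const).add
    ((continuousAt_const.add (continuousAt_const.mul h3)).mul continuousAt_const)).sub h4

/-- For `θ̂ ∈ (π, 5π/4)`, if `Ω₄ > 0`, `Ω₂ > csc²(θ̂)Ω₄` and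
`3Ω₂ − 6 cot(θ̂)Ω₃ + (3csc²(θ̂) − 4)Ω₄ > 0` (both consequences of the existence of a
C-subsolution), then there exists `ℓ ∈ [1, −sec θ̂)` with
`(Ω₂, Ω₃, Ω₄) ∈ Ω^{4,θ̂}_ℓ`. -/
theorem stmt_18 (θ : ℝ) (hθ : θ ∈ Set.Ioo Real.pi (5 * Real.pi / 4))
    (Ω₂ Ω₃ Ω₄ : ℝ) (h4 : 0 < Ω₄)
    (hC1 : Ω₄ / Real.sin θ ^ 2 < Ω₂)
    (hC2 : 0 < 3 * Ω₂ - 6 * (Real.cos θ / Real.sin θ) * Ω₃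
      + (3 / Real.sin θ ^ 2 - 4) * Ω₄) :
    ∃ ℓ ∈ Set.Ico (1 : ℝ) (-(1 / Real.cos θ)),
      ∀ t ∈ Set.Ico (0 : ℝ) 1,
        Ω₃ < 3 * (1 - (1 + (1 - t) * ℓ * Real.cos θ) ^ ((2 : ℝ) / 3))
            * (Real.sin θ / Real.cos θ) / (4 * (1 - t)) * Ω₂
          + (3 / Real.sin θ ^ 2 - 4
              + 24 * ((1 + (1 - t) * ℓ * Real.cos θ) ^ ((2 : ℝ) / 3)) ^ 2
                * (1 / Real.sin θ ^ 2)
                * Real.cos ((1 / 3) * Real.arccos (t * Real.cos θ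
                    / ((1 + (1 - t) * ℓ * Real.cos θ) ^ ((2 : ℝ) / 3)) ^ ((3 : ℝ) / 2))) ^ 2
                * Real.cos (2 * ((1 / 3) * Real.arccos (t * Real.cos θ
                    / ((1 + (1 - t) * ℓ * Real.cos θ) ^ ((2 : ℝ) / 3)) ^ ((3 : ℝ) / 2)))))
            * (Real.sin θ / Real.cos θ) / (8 * (1 - t)) * Ω₄ := by
  obtain ⟨x, hx, hw0, hw1, hg⟩ := x_facts θ hθ
  obtain ⟨h1, h2⟩ := hθ
  have hpi := Real.pi_pos
  have hs : Real.sin θ < 0 := by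
    have := Real.sin_pos_of_pos_of_lt_pi (x := θ - Real.pi) (by linarith) (by linarith)
    rw [Real.sin_sub_pi] at this
    linarith
  have hc : Real.cos θ < 0 :=
    Real.cos_neg_of_pi_div_two_lt_of_lt (by linarith) (by linarith)
  have hS : 0 < Real.sin θ ^ 2 := by nlinarith
  have hCS : Real.sin θ ^ 2 = 1 - Real.cos θ ^ 2 := Real.sin_sq θ
  have hl : 1 < -(1 / Real.cos θ) := by
    rw [← one_div_neg_eq_neg_one_div, lt_div_iff₀ (by linarith)]
    nlinarith
  have hev : ∀ t ∈ Set.Icc (0 : ℝ) 1, ∀ᶠ q : ℝ × ℝ in nhds (-(1 / Real.cos θ), t),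
      0 < FAux (Real.cos θ) (Real.sin θ ^ 2) (Real.cos θ / Real.sin θ) Ω₂ Ω₃ Ω₄ q.1 q.2 := by
    rintro t ⟨ht0, ht1⟩
    have hb : 1 + (1 - t) * (-(1 / Real.cos θ)) * Real.cos θ = t := by
      field_simp [hc.ne]
      ring
    refine (FAux_cont _ _ _ Ω₂ Ω₃ Ω₄ _ t (by rw [hb]; exact ht0)).eventually_const_lt ?_
    simp only [FAux]
    rw [hb]
    obtain ⟨u, hu0, rfl⟩ : ∃ u : ℝ, 0 ≤ u ∧ u ^ 3 = t :=
      ⟨t ^ ((1 : ℝ) / 3), Real.rpow_nonneg ht0 _, by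
        rw [← Real.rpow_natCast, ← Real.rpow_mul ht0]; norm_num⟩
    have hu1 : u ≤ 1 := by
      by_contra hcon
      push Not at hcon
      have := one_lt_pow₀ hcon (n := 3) (by norm_num)
      linarith
    have e1 : (u ^ 3) ^ ((2 : ℝ) / 3) = u ^ 2 := by
      rw [← Real.rpow_natCast, ← Real.rpow_mul hu0, ← Real.rpow_natCast]; norm_num
    have e2 : (u ^ 2) ^ ((3 : ℝ) / 2) = u ^ 3 := by
      rw [← Real.rpow_natCast, ← Real.rpow_mul hu0, ← Real.rpow_natCast]; norm_num
    rw [e1, e2]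
    apply F_pos (Real.cos θ) (Real.sin θ ^ 2) Ω₂ Ω₃ Ω₄ u _ x hS hCS _ h4 hC1 hC2 hu0 hu1 hx hw0 hw1
    rcases hu0.eq_or_lt with h | h
    · simp [← h]
    · rw [mul_div_cancel_left₀ _ (pow_pos h 3).ne', hg]
      ring
  have hcomp := (isCompact_Icc (a := (0 : ℝ)) (b := 1)).eventually_forall_of_forall_eventually
    (x₀ := -(1 / Real.cos θ)) (P := fun l t => 0 < FAux (Real.cos θ) (Real.sin θ ^ 2)
      (Real.cos θ / Real.sin θ) Ω₂ Ω₃ Ω₄ l t) hev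
  have hleft : ∀ᶠ l in nhdsWithin (-(1 / Real.cos θ)) (Set.Iio (-(1 / Real.cos θ))),
      l ∈ Set.Ico (1 : ℝ) (-(1 / Real.cos θ)) := Ico_mem_nhdsLT hl
  obtain ⟨l, hl1, hl2⟩ := (hleft.and (hcomp.filter_mono nhdsWithin_le_nhds)).exists
  refine ⟨l, hl1, ?_⟩
  rintro t ⟨ht0, ht1⟩
  have hF := hl2 t ⟨ht0, ht1.le⟩
  have ht : 0 < 1 - t := by linarith
  have hT : 0 < Real.sin θ / Real.cos θ / (8 * (1 - t)) :=
    div_pos (div_pos_of_neg_of_neg hs hc) (by linarith)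
  have hp := mul_pos hT hF
  rw [← sub_pos]
  simp only [FAux, gAux] at hp
  generalize (1 + (1 - t) * l * Real.cos θ) ^ ((2 : ℝ) / 3) = c at *
  generalize Real.cos (1 / 3 * Real.arccos (t * Real.cos θ / c ^ ((3 : ℝ) / 2))) = A at *
  generalize Real.cos (2 * (1 / 3 * Real.arccos (t * Real.cos θ / c ^ ((3 : ℝ) / 2)))) = B at *
  have hs' := hs.ne
  have hc' := hc.ne
  have ht' := ht.ne'
  refine lt_of_lt_of_eq hp ?_
  field_simp
  ring
end

section
/- For every real θ ∈ (−π/3, −π/4) and every t ∈ [0, 1], one has 2 + 4t − 6·t^{2/3} + (4t − 1)·(3 − 4·sin²(3θ))/3 + 24·t^{4/3}·cos²(θ)·cos(2θ) > 0. -/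
/-- For every `θ ∈ (−π/3, −π/4)` and `t ∈ [0, 1]`:
`2 + 4t − 6t^{2/3} + (4t − 1)(3 − 4 sin²(3θ))/3 + 24 t^{4/3} cos²(θ) cos(2θ) > 0`. -/
theorem stmt_19 (θ t : ℝ) (hθ : θ ∈ Set.Ioo (-(Real.pi / 3)) (-(Real.pi / 4)))
    (ht : t ∈ Set.Icc (0 : ℝ) 1) :
    0 < 2 + 4 * t - 6 * t ^ ((2 : ℝ) / 3)
      + (4 * t - 1) * (3 - 4 * Real.sin (3 * θ) ^ 2) / 3
      + 24 * t ^ ((4 : ℝ) / 3) * Real.cos θ ^ 2 * Real.cos (2 * θ) := by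
  obtain ⟨h1, h2⟩ := hθ
  obtain ⟨ht0, ht1⟩ := ht
  have hpi := Real.pi_pos
  obtain ⟨s, hs⟩ : ∃ s : ℝ, s = t ^ ((1 : ℝ) / 3) := ⟨_, rfl⟩
  have hs0 : 0 ≤ s := hs ▸ Real.rpow_nonneg ht0 _
  have hs1 : s ≤ 1 := hs ▸ Real.rpow_le_one ht0 ht1 (by norm_num)
  have e1 : t = s ^ 3 := by
    rw [hs, ← Real.rpow_natCast, ← Real.rpow_mul ht0]; norm_num
  have e2 : t ^ ((2 : ℝ) / 3) = s ^ 2 := by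
    rw [hs, ← Real.rpow_natCast, ← Real.rpow_mul ht0]; norm_num
  have e4 : t ^ ((4 : ℝ) / 3) = s ^ 4 := by
    rw [hs, ← Real.rpow_natCast, ← Real.rpow_mul ht0]; norm_num
  have hc : Real.cos (2 * θ) = 2 * Real.cos θ ^ 2 - 1 := Real.cos_two_mul θ
  have hlo : -(1 / 2) < Real.cos (2 * θ) := by
    have h : Real.cos (Real.pi - Real.pi / 3) < Real.cos (-(2 * θ)) :=
      Real.cos_lt_cos_of_nonneg_of_le_pi (by linarith) (by linarith) (by linarith)
    rw [Real.cos_pi_sub, Real.cos_pi_div_three, Real.cos_neg] at h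
    exact h
  have hhi : Real.cos (2 * θ) < 0 := by
    rw [← Real.cos_neg]
    exact Real.cos_neg_of_pi_div_two_lt_of_lt (by linarith) (by linarith)
  have hsin : Real.sin (3 * θ) ^ 2
      = 1 - (4 * Real.cos θ ^ 3 - 3 * Real.cos θ) ^ 2 := by
    rw [Real.sin_sq, Real.cos_three_mul]
  rw [e2, e4, hsin, e1, hc]
  rw [hc] at hlo hhi
  obtain ⟨u, hu⟩ : ∃ u : ℝ, u = 4 * Real.cos θ ^ 2 - 1 := ⟨_, rfl⟩
  have hu0 : 0 < u := by linarith
  have hu1 : u < 1 := by linarith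
  have hA : 0 ≤ (1 - s) ^ 2 * (3 * s ^ 2 + 2 * s + 1) := by positivity
  have hB : 0 < 3 * s ^ 4 - 8 / 3 * s ^ 3 + 2 / 3 := by
    nlinarith [sq_nonneg (s ^ 2 - 4 / 9 * s - 1 / 4), sq_nonneg (s - 2 / 3), sq_nonneg (s ^ 2 - 4 / 9), sq_nonneg (s * (s - 2 / 3))]
  have hC : 0 ≤ (1 - s) ^ 3 * (1 + 3 * s) :=
    mul_nonneg (pow_nonneg (by linarith) 3) (by linarith)
  have hD : 0 < (1 - u) * ((1 - s) ^ 2 * (3 * s ^ 2 + 2 * s + 1))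
      + u * (3 * s ^ 4 - 8 / 3 * s ^ 3 + 2 / 3) :=
    add_pos_of_nonneg_of_pos (mul_nonneg (by linarith) hA) (mul_pos hu0 hB)
  have hE := add_pos_of_nonneg_of_pos hC (mul_pos (pow_pos hu0 2) hD)
  refine lt_of_lt_of_eq hE ?_
  rw [hu]
  ring
end
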